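/- (Cauchy integral formula, fractional case.) Assume g and h are affine: g(u) = δ₁u + δ₂, h(v) = ρ₁v + ρ₂ with δ₁, ρ₁ > 0, and let f ∈ _{RL}SM^{(α,β)}_{(g,h)}(S_{a,b,c}). Let I ∈ 𝕊, z₀ ∈ ℂ_I and ρ > 0 be such that the closed disc {z ∈ ℂ_I : |z − z₀| ≤ ρ} is contained in S_{a,b,c,I}. Then for every z ∈ ℂ_I with |z − z₀| < ρ, F_I(z) = (1/2π) ∫_0^{2π} (w(θ) − z)^{−1} w′(θ) (−I) F_I(w(θ)) dθ, where w(θ) := z₀ + ρ(cos θ + I sin θ), w′(θ) := ρ(−sin θ + I cos θ), the inverse is taken in ℂ_I, and F_I(u + Iv) := (1/δ₁) A_I(u) + (1/ρ₁) B_I(v). -/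

import Mathlib

open scoped BigOperators
open Set

noncomputable section

/-- The sphere 𝕊 of (coefficient vectors of) unit 1-vectors in ℝⁿ. -/
def USphere (n : ℕ) : Set (Fin n → ℝ) := {x | ∑ i, x i ^ 2 = 1}

/-- Points of ℝ^{n+1}, written as (x₀, (x₁, …, xₙ)). -/
abbrev Pt (n : ℕ) := ℝ × (Fin n → ℝ)

variable {n : ℕ} {Cl : Type} [NormedRing Cl] [NormedAlgebra ℝ Cl]

/-- The 1-vector of the Clifford algebra with coefficients `x` w.r.t. generators `e`. -/
def vecEmb (e : Fin n → Cl) (x : Fin n → ℝ) : Cl := ∑ i, x i • e i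

/-- The defining relations `eᵢeⱼ + eⱼeᵢ = -2δᵢⱼ` of the Clifford algebra ℝₙ. -/
def CliffordRel (e : Fin n → Cl) : Prop :=
  ∀ i j, e i * e j + e j * e i = if i = j then (-2 : Cl) else 0

/-- The slice Cauchy–Riemann operator `(∂/∂u + I ∂/∂v)` applied to the restriction of `f`
to the slice `ℂ_I`, `I = vecEmb e x`, evaluated at the point `u + I v`. -/
def sliceCR (e : Fin n → Cl) (f : Pt n → Cl) (x : Fin n → ℝ) (u v : ℝ) : Cl :=
  deriv (fun t => f (t, v • x)) u + vecEmb e x * deriv (fun t => f (u, t • x)) v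

/-- λ-slice monogenic functions on `U`. -/
def SMlam (e : Fin n → Cl) (lam : ℝ) (U : Set (Pt n)) (f : Pt n → Cl) : Prop :=
  ContDiffOn ℝ 1 f U ∧
  ∀ x ∈ USphere n, ∀ u v : ℝ, ((u, v • x) : Pt n) ∈ U →
    sliceCR e f x u v + lam • f (u, v • x) = 0

/-- The coordinates (u,v) of the slice `U_I = U ∩ ℂ_I`, `I = vecEmb e x`. -/
def SlicePre (n : ℕ) (U : Set (Pt n)) (x : Fin n → ℝ) : Set (ℝ × ℝ) :=
  {p | ((p.1, p.2 • x) : Pt n) ∈ U}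

/-- Axially symmetric slice domains in ℝ^{n+1}. -/
def AxSymSDomain (n : ℕ) (U : Set (Pt n)) : Prop :=
  IsOpen U ∧ IsConnected U ∧ (∃ u : ℝ, ((u, (0 : Fin n → ℝ)) : Pt n) ∈ U) ∧
  (∀ x ∈ USphere n, IsConnected (SlicePre n U x)) ∧
  ∀ x ∈ USphere n, ∀ y ∈ USphere n, ∀ u v : ℝ,
    ((u, v • x) : Pt n) ∈ U → ((u, v • y) : Pt n) ∈ U

/-- A holomorphic function with values in `ℂ_I`, `I = vecEmb e x`, on a
(relatively open) coordinate set `V`. -/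
def SliceHolo (e : Fin n → Cl) (x : Fin n → ℝ) (V : Set (ℝ × ℝ)) (F : ℝ × ℝ → Cl) : Prop :=
  DifferentiableOn ℝ F V ∧
  (∀ p ∈ V, ∃ a b : ℝ, F p = algebraMap ℝ Cl a + b • vecEmb e x) ∧
  ∀ p ∈ V, deriv (fun t => F (t, p.2)) p.1 + vecEmb e x * deriv (fun t => F (p.1, t)) p.2 = 0

/-- Ordered product `I_A = I_{i₁} ⋯ I_{i_k}` over a finite index set `A`. -/
def IAprod (e : Fin n → Cl) (J : Fin n → Fin n → ℝ) (A : Finset (Fin n)) : Cl :=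
  ((A.sort (· ≤ ·)).map fun i => vecEmb e (J i)).prod

/-- A closed piecewise-C¹ curve parametrized on [0,1]. -/
def PiecewiseC1 (γ : ℝ → ℝ × ℝ) : Prop :=
  ContinuousOn γ (Icc 0 1) ∧
  ∃ (k : ℕ) (t : Fin (k + 1) → ℝ), t 0 = 0 ∧ t (Fin.last k) = 1 ∧ StrictMono t ∧
    ∀ i : Fin k, ContDiffOn ℝ 1 γ (Icc (t i.castSucc) (t i.succ))

/-- `γ` is a closed curve in `V`, homotopic within `V` to a constant curve. -/
def NullHomotopicIn (γ : ℝ → ℝ × ℝ) (V : Set (ℝ × ℝ)) : Prop :=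
  γ 0 = γ 1 ∧ (∀ t ∈ Icc (0:ℝ) 1, γ t ∈ V) ∧
  ∃ (H : ℝ × ℝ → ℝ × ℝ) (p : ℝ × ℝ),
    ContinuousOn H (Icc 0 1 ×ˢ Icc 0 1) ∧
    (∀ q ∈ (Icc (0:ℝ) 1 ×ˢ Icc (0:ℝ) 1), H q ∈ V) ∧
    (∀ t ∈ Icc (0:ℝ) 1, H (0, t) = γ t) ∧
    (∀ t ∈ Icc (0:ℝ) 1, H (1, t) = p) ∧
    (∀ s ∈ Icc (0:ℝ) 1, H (s, 0) = H (s, 1))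

/-- The inverse `(a + bI)⁻¹` computed in the field `ℂ_I`, `I = vecEmb e x`. -/
def sliceInv (e : Fin n → Cl) (x : Fin n → ℝ) (a b : ℝ) : Cl :=
  (a ^ 2 + b ^ 2)⁻¹ • (algebraMap ℝ Cl a - b • vecEmb e x)

/-- The closed Euclidean ball of ℝ^{n+1}. -/
def EucClosedBall (y : Pt n) (ρ : ℝ) : Set (Pt n) :=
  {p | (p.1 - y.1) ^ 2 + ∑ i, (p.2 i - y.2 i) ^ 2 ≤ ρ ^ 2}

/-- Left fractional integral of order `σ` with respect to `g` (with derivative `g'`),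
with base point `aa`. -/
def fracInt (aa σ : ℝ) (g g' : ℝ → ℝ) (φ : ℝ → Cl) (u : ℝ) : Cl :=
  (Real.Gamma σ)⁻¹ • ∫ τ in aa..u, ((g u - g τ) ^ (σ - 1) * g' τ) • φ τ

/-- Right fractional integral of order `σ` with respect to `h` (with derivative `h'`),
with base point `cc`. -/
def fracIntR (cc σ : ℝ) (h h' : ℝ → ℝ) (φ : ℝ → Cl) (v : ℝ) : Cl :=
  (Real.Gamma σ)⁻¹ • ∫ τ in v..cc, ((h τ - h v) ^ (σ - 1) * h' τ) • φ τ

/-- Left Riemann–Liouville fractional derivative of order `al` w.r.t. `g` on `[aa, bb]`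
(one-sided derivatives at the endpoints). -/
def rlD (aa bb al : ℝ) (g g' : ℝ → ℝ) (φ : ℝ → Cl) (u : ℝ) : Cl :=
  (g' u)⁻¹ • derivWithin (fracInt aa (1 - al) g g' φ) (Icc aa bb) u

/-- The set `S_{a,b,c} ⊆ ℝ^{n+1}`. -/
def Sabc (n : ℕ) (a b c : ℝ) : Set (Pt n) :=
  {p | ∃ x ∈ USphere n, ∃ u ∈ Icc a b, ∃ v ∈ Icc 0 c, p = ((u, v • x) : Pt n)}

/-- Absolutely continuous function on `[a,b]`. -/
def AbsContOn {E : Type} [NormedAddCommGroup E] (φ : ℝ → E) (a b : ℝ) : Prop :=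
  ∀ ε > (0:ℝ), ∃ δ > (0:ℝ), ∀ (k : ℕ) (p q : Fin k → ℝ),
    (∀ i, p i ∈ Icc a b ∧ q i ∈ Icc a b ∧ p i ≤ q i) →
    (∀ i j, i ≠ j → Ioo (p i) (q i) ∩ Ioo (p j) (q j) = ∅) →
    (∑ i, (q i - p i)) < δ → (∑ i, ‖φ (q i) - φ (p i)‖) < ε

/-- The class `AC¹(S_{a,b,c}, ℝₙ)`. -/
def AC1 (a b c r s : ℝ) (f : Pt n → Cl) : Prop :=
  ContinuousOn f (Sabc n a b c) ∧
  ∀ x ∈ USphere n,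
    AbsContOn (fun u => f (u, s • x)) a b ∧ AbsContOn (fun v => f (r, v • x)) 0 c

/-- `A_I(u) = (I_{a+}^{1-α,g}[τ ↦ f(τ + Is)])(u)`, where `I = vecEmb e x`. -/
def AIfun (a al s : ℝ) (g g' : ℝ → ℝ) (f : Pt n → Cl) (x : Fin n → ℝ) : ℝ → Cl :=
  fracInt a (1 - al) g g' fun τ => f (τ, s • x)

/-- `B_I(v) = (I_{0+}^{1-β,h}[τ ↦ f(r + Iτ)])(v)`, where `I = vecEmb e x`. -/
def BIfun (be r : ℝ) (h h' : ℝ → ℝ) (f : Pt n → Cl) (x : Fin n → ℝ) : ℝ → Cl :=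
  fracInt 0 (1 - be) h h' fun τ => f (r, τ • x)

/-- `B_I^{c-}(v) = (I_{c-}^{1-β,h}[τ ↦ f(r + Iτ)])(v)`, where `I = vecEmb e x`. -/
def BIcfun (c be r : ℝ) (h h' : ℝ → ℝ) (f : Pt n → Cl) (x : Fin n → ℝ) : ℝ → Cl :=
  fracIntR c (1 - be) h h' fun τ => f (r, τ • x)

/-- Condition (m1): the maps `A_I` and `B_I` are of class C¹ for every `I ∈ 𝕊`. -/
def M1 (a b c al be r s : ℝ) (g g' h h' : ℝ → ℝ) (f : Pt n → Cl) : Prop :=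
  ∀ x ∈ USphere n,
    ContDiffOn ℝ 1 (AIfun a al s g g' f x) (Icc a b) ∧
    ContDiffOn ℝ 1 (BIfun be r h h' f x) (Icc 0 c)

/-- Riemann–Liouville fractional slice monogenic functions of order `(α,β)`
with respect to `(g,h)` on `S_{a,b,c}`. -/
def RLSM (a b c al be r s : ℝ) (g g' h h' : ℝ → ℝ) (e : Fin n → Cl) (f : Pt n → Cl) : Prop :=
  AC1 a b c r s f ∧ M1 a b c al be r s g g' h h' f ∧
  ∀ x ∈ USphere n, ∀ u ∈ Icc a b, ∀ v ∈ Icc 0 c,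
    (g' u)⁻¹ • derivWithin (AIfun a al s g g' f x) (Icc a b) u +
      vecEmb e x * ((h' v)⁻¹ • derivWithin (BIfun be r h h' f x) (Icc 0 c) v) = 0


theorem CliffordRel.vecEmb_mul_self {e : Fin n → Cl} (he : CliffordRel e) {x : Fin n → ℝ}
    (hx : x ∈ USphere n) : vecEmb e x * vecEmb e x = -1 := by
  have expand : vecEmb e x * vecEmb e x = ∑ i, ∑ j, (x i * x j) • (e i * e j) := by
    simp only [vecEmb, Finset.sum_mul_sum, smul_mul_smul_comm]
  have expand' : vecEmb e x * vecEmb e x = ∑ i, ∑ j, (x i * x j) • (e j * e i) := by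
    rw [expand, Finset.sum_comm]
    exact Finset.sum_congr rfl fun j _ => Finset.sum_congr rfl fun i _ => by
      rw [mul_comm (x i)]
  have double : vecEmb e x * vecEmb e x + vecEmb e x * vecEmb e x = (-2 : Cl) := by
    nth_rewrite 1 [expand]
    rw [expand']
    simp only [← Finset.sum_add_distrib, ← smul_add, he _ _, smul_ite, smul_zero,
      Finset.sum_ite_eq, Finset.mem_univ, if_true, ← Finset.sum_smul, ← pow_two]
    rw [show ∑ i, x i ^ 2 = 1 from hx, one_smul]
  have hsmul : (2 : ℝ) • (vecEmb e x * vecEmb e x) = (2 : ℝ) • (-1 : Cl) := by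
    rw [two_smul, two_smul, double]
    norm_num
  exact smul_right_injective Cl (two_ne_zero' ℝ) hsmul

/-- The embedding `u + iv ↦ u + Iv` of `ℂ` as the slice `ℂ_I`, `I * I = -1`,
as a continuous linear map. -/
def sliceCLM (I : Cl) (hI : I * I = -1) : ℂ →L[ℝ] Cl :=
  LinearMap.toContinuousLinearMap (Complex.liftAux I hI).toLinearMap

theorem sliceCLM_apply (I : Cl) (hI : I * I = -1) (z : ℂ) :
    sliceCLM I hI z = algebraMap ℝ Cl z.re + z.im • I :=
  Complex.liftAux_apply I hI z

theorem sliceCLM_mul (I : Cl) (hI : I * I = -1) (z w : ℂ) :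
    sliceCLM I hI (z * w) = sliceCLM I hI z * sliceCLM I hI w :=
  map_mul (Complex.liftAux I hI) z w

theorem sliceInv_eq_sliceCLM (e : Fin n → Cl) (x : Fin n → ℝ)
    (hI : vecEmb e x * vecEmb e x = -1) (z : ℂ) :
    sliceInv e x z.re z.im = sliceCLM (vecEmb e x) hI z⁻¹ := by
  rw [sliceCLM_apply, sliceInv, Complex.inv_re, Complex.inv_im, Complex.normSq_apply,
    Algebra.algebraMap_eq_smul_one, Algebra.algebraMap_eq_smul_one, smul_sub, smul_smul,
    smul_smul, sub_eq_add_neg, ← neg_smul]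
  congr 2 <;> ring

/-- The Cauchy integral formula on a circle, in the parametrization by the angle. -/
theorem cauchy_circleMap {z₀ z : ℂ} {ρ : ℝ} (hz : z ∈ Metric.ball z₀ ρ) {F : ℂ → ℂ}
    (hF : Differentiable ℂ F) :
    ∫ θ in (0:ℝ)..(2 * Real.pi), (circleMap z₀ ρ θ - z)⁻¹ * deriv (circleMap z₀ ρ) θ *
      (-Complex.I) * F (circleMap z₀ ρ θ) = (2 * Real.pi : ℝ) * F z := by
  have cauchy := Complex.circleIntegral_sub_inv_smul_of_differentiable_on_off_countable
    (s := ∅) countable_empty hz hF.continuous.continuousOn (fun w _ => hF w)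
  rw [circleIntegral] at cauchy
  calc _ = ∫ θ in (0:ℝ)..(2 * Real.pi), (-Complex.I) * (deriv (circleMap z₀ ρ) θ •
          ((circleMap z₀ ρ θ - z)⁻¹ • F (circleMap z₀ ρ θ))) := by
        refine intervalIntegral.integral_congr fun θ _ => ?_
        simp only [smul_eq_mul]
        ring
    _ = _ := by
        rw [intervalIntegral.integral_const_mul, cauchy, smul_eq_mul]
        push_cast
        linear_combination (-(2 * Real.pi * F z) : ℂ) * Complex.I_mul_I

theorem continuous_cauchy_circleMap {z₀ z : ℂ} {ρ : ℝ} (hz : z ∈ Metric.ball z₀ ρ) {F : ℂ → ℂ}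
    (hF : Continuous F) :
    Continuous fun θ => (circleMap z₀ ρ θ - z)⁻¹ * deriv (circleMap z₀ ρ) θ *
      (-Complex.I) * F (circleMap z₀ ρ θ) := by
  have hne (θ : ℝ) : circleMap z₀ ρ θ - z ≠ 0 :=
    sub_ne_zero.2 (circleMap_ne_mem_ball hz θ)
  have hc := continuous_circleMap z₀ ρ
  have hd : Continuous (deriv (circleMap z₀ ρ)) := by
    simp only [funext (deriv_circleMap z₀ ρ)]
    exact (continuous_circleMap 0 ρ).mul continuous_const
  exact ((((hc.sub continuous_const).inv₀ hne).mul hd).mul continuous_const).mul (hF.comp hc)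

/-- The Cauchy integral formula for the affine function `w ↦ w K + E` on a slice. -/
theorem cauchy_slice_affine [CompleteSpace Cl] (I : Cl) (hI : I * I = -1) (K E : Cl)
    {z₀ z : ℂ} {ρ : ℝ} (hz : z ∈ Metric.ball z₀ ρ) :
    ∫ θ in (0:ℝ)..(2 * Real.pi), sliceCLM I hI ((circleMap z₀ ρ θ - z)⁻¹ *
        deriv (circleMap z₀ ρ) θ * (-Complex.I)) *
          (sliceCLM I hI (circleMap z₀ ρ θ) * K + E)
      = (2 * Real.pi) • (sliceCLM I hI z * K + E) := by
  have key (F : ℂ → ℂ) (hF : Differentiable ℂ F) (L : Cl) :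
      IntervalIntegrable (fun θ => sliceCLM I hI ((circleMap z₀ ρ θ - z)⁻¹ *
        deriv (circleMap z₀ ρ) θ * (-Complex.I) * F (circleMap z₀ ρ θ)) * L)
        MeasureTheory.volume 0 (2 * Real.pi) ∧
      ∫ θ in (0:ℝ)..(2 * Real.pi), sliceCLM I hI ((circleMap z₀ ρ θ - z)⁻¹ *
        deriv (circleMap z₀ ρ) θ * (-Complex.I) * F (circleMap z₀ ρ θ)) * L
        = (2 * Real.pi) • (sliceCLM I hI (F z) * L) := by
    have hcont := continuous_cauchy_circleMap hz hF.continuous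
    refine ⟨(((sliceCLM I hI).continuous.comp hcont).mul continuous_const).intervalIntegrable
      _ _, ?_⟩
    have comm := (((ContinuousLinearMap.mul ℝ Cl).flip L).comp
      (sliceCLM I hI)).intervalIntegral_comp_comm
        (hcont.intervalIntegrable (μ := MeasureTheory.volume) 0 (2 * Real.pi))
    rw [cauchy_circleMap hz hF, ← Complex.real_smul, map_smul] at comm
    exact comm
  obtain ⟨intK, eqK⟩ := key id differentiable_id K
  obtain ⟨intE, eqE⟩ := key (fun _ => 1) (differentiable_const 1) E
  rw [smul_add, ← show sliceCLM I hI 1 * E = E by simp [sliceCLM_apply], ← eqE]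
  simp only [id] at eqK intK
  rw [← eqK, ← intervalIntegral.integral_add intK intE]
  refine intervalIntegral.integral_congr fun θ _ => ?_
  simp [sliceCLM_mul, mul_add, mul_assoc, sliceCLM_apply I hI 1]

theorem eq_smul_add_of_derivWithin_const {E : Type*} [NormedAddCommGroup E] [NormedSpace ℝ E]
    {φ : ℝ → E} {a b : ℝ} {K : E} (hab : a < b) (hφ : DifferentiableOn ℝ φ (Icc a b))
    (hd : ∀ t ∈ Icc a b, derivWithin φ (Icc a b) t = K) :
    ∀ t ∈ Icc a b, φ t = t • K + (φ a - a • K) := by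
  have hlin (t : ℝ) : HasDerivWithinAt (fun t : ℝ => t • K) K (Icc a b) t := by
    simpa using (hasDerivWithinAt_id t (Icc a b)).smul_const K
  have hsub (t : ℝ) (ht : t ∈ Icc a b) :
      HasDerivWithinAt (fun t : ℝ => φ t - t • K) 0 (Icc a b) t := by
    have h := (hφ t ht).hasDerivWithinAt.sub (hlin t)
    rwa [hd t ht, sub_self] at h
  intro t ht
  have h := constant_of_derivWithin_zero (fun t ht => (hsub t ht).differentiableWithinAt)
    (fun t ht => (hsub t (Ico_subset_Icc_self ht)).derivWithin
      (uniqueDiffOn_Icc hab t (Ico_subset_Icc_self ht))) t ht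
  rw [← h]
  abel

/-- Cauchy integral formula for `F_I(u+Iv) = (1/δ₁)A_I(u) + (1/ρ₁)B_I(v)`,
fractional case with affine `g`, `h`. -/
theorem statement13 [CompleteSpace Cl] (e : Fin n → Cl) (he : CliffordRel e)
    (a b c r s al be δ₁ δ₂ ρ₁ ρ₂ : ℝ)
    (hab : a < b) (hc : 0 < c) (hr : r ∈ Icc a b) (hs : s ∈ Icc 0 c)
    (hal : al ∈ Ioo (0:ℝ) 1) (hbe : be ∈ Ioo (0:ℝ) 1)
    (hδ : 0 < δ₁) (hρ : 0 < ρ₁)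
    (f : Pt n → Cl)
    (hf : RLSM a b c al be r s (fun u => δ₁ * u + δ₂) (fun _ => δ₁)
      (fun v => ρ₁ * v + ρ₂) (fun _ => ρ₁) e f)
    (x : Fin n → ℝ) (hx : x ∈ USphere n)
    (u₀ v₀ ρ : ℝ) (hρ0 : 0 < ρ)
    (hdisc : {p : ℝ × ℝ | (p.1 - u₀) ^ 2 + (p.2 - v₀) ^ 2 ≤ ρ ^ 2}
      ⊆ (Icc a b ×ˢ Icc 0 c : Set (ℝ × ℝ)))
    (u v : ℝ) (hz : (u - u₀) ^ 2 + (v - v₀) ^ 2 < ρ ^ 2) :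
    δ₁⁻¹ • AIfun a al s (fun u => δ₁ * u + δ₂) (fun _ => δ₁) f x u
      + ρ₁⁻¹ • BIfun be r (fun v => ρ₁ * v + ρ₂) (fun _ => ρ₁) f x v
    = (2 * Real.pi)⁻¹ • ∫ θ in (0:ℝ)..(2 * Real.pi),
        sliceInv e x (u₀ + ρ * Real.cos θ - u) (v₀ + ρ * Real.sin θ - v) *
          ((ρ * (-Real.sin θ)) • (1 : Cl) + (ρ * Real.cos θ) • vecEmb e x) *
          (-(vecEmb e x)) *
          (δ₁⁻¹ • AIfun a al s (fun u => δ₁ * u + δ₂) (fun _ => δ₁) f x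
              (u₀ + ρ * Real.cos θ)
            + ρ₁⁻¹ • BIfun be r (fun v => ρ₁ * v + ρ₂) (fun _ => ρ₁) f x
              (v₀ + ρ * Real.sin θ)) := by
  obtain ⟨-, hm1, hcr⟩ := hf
  obtain ⟨hA, hB⟩ := hm1 x hx
  replace hcr := hcr x hx
  set A := AIfun a al s (fun u => δ₁ * u + δ₂) (fun _ => δ₁) f x
  set B := BIfun be r (fun v => ρ₁ * v + ρ₂) (fun _ => ρ₁) f x
  have hI := he.vecEmb_mul_self hx
  set K : Cl := δ₁⁻¹ • derivWithin A (Icc a b) a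
  have hB' (t : ℝ) (ht : t ∈ Icc 0 c) :
      ρ₁⁻¹ • derivWithin B (Icc 0 c) t = vecEmb e x * K := by
    have h := congrArg (vecEmb e x * ·) (hcr a (left_mem_Icc.2 hab.le) t ht)
    simp only [mul_add, ← mul_assoc, hI, mul_zero, neg_mul, one_mul] at h
    exact (sub_eq_zero.1 (by rwa [sub_eq_add_neg])).symm
  have hA' (t : ℝ) (ht : t ∈ Icc a b) : δ₁⁻¹ • derivWithin A (Icc a b) t = K := by
    have h := hcr t ht 0 (left_mem_Icc.2 hc.le)
    rw [hB' 0 (left_mem_Icc.2 hc.le), ← mul_assoc, hI, neg_mul, one_mul] at h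
    exact add_neg_eq_zero.1 h
  have hA1 := eq_smul_add_of_derivWithin_const hab
    ((hA.differentiableOn one_ne_zero).const_smul δ₁⁻¹) fun t ht => by
      rw [derivWithin_const_smul _ (hA.differentiableOn one_ne_zero t ht)]
      exact hA' t ht
  have hB1 := eq_smul_add_of_derivWithin_const hc
    ((hB.differentiableOn one_ne_zero).const_smul ρ₁⁻¹) fun t ht => by
      rw [derivWithin_const_smul _ (hB.differentiableOn one_ne_zero t ht)]
      exact hB' t ht
  obtain ⟨E, hF⟩ : ∃ E : Cl, ∀ w : ℂ, (w.re - u₀) ^ 2 + (w.im - v₀) ^ 2 ≤ ρ ^ 2 →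
      δ₁⁻¹ • A w.re + ρ₁⁻¹ • B w.im = sliceCLM (vecEmb e x) hI w * K + E := by
    refine ⟨(δ₁⁻¹ • A a - a • K) + (ρ₁⁻¹ • B 0 - (0:ℝ) • (vecEmb e x * K)), fun w hw => ?_⟩
    obtain ⟨hwu, hwv⟩ := hdisc (show (w.re, w.im) ∈ _ from hw)
    have h1 := hA1 w.re hwu
    have h2 := hB1 w.im hwv
    simp only [Pi.smul_apply] at h1 h2
    rw [h1, h2, sliceCLM_apply, add_mul, ← Algebra.smul_def, smul_mul_assoc]
    abel
  have hz' : (⟨u, v⟩ : ℂ) ∈ Metric.ball (⟨u₀, v₀⟩ : ℂ) ρ := by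
    rw [Metric.mem_ball, Complex.dist_eq_re_im]
    exact (Real.sqrt_lt' hρ0).2 hz
  rw [hF ⟨u, v⟩ hz.le, eq_inv_smul_iff₀ Real.two_pi_pos.ne',
    ← cauchy_slice_affine (vecEmb e x) hI K E hz']
  refine intervalIntegral.integral_congr fun θ _ => ?_
  have hre : (circleMap ⟨u₀, v₀⟩ ρ θ).re = u₀ + ρ * Real.cos θ := by
    simp [circleMap, Complex.exp_re]
  have him : (circleMap ⟨u₀, v₀⟩ ρ θ).im = v₀ + ρ * Real.sin θ := by
    simp [circleMap, Complex.exp_im]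
  have hval := hF (circleMap ⟨u₀, v₀⟩ ρ θ) (by
    rw [hre, him]
    nlinarith [Real.sin_sq_add_cos_sq θ])
  have hinv := sliceInv_eq_sliceCLM e x hI (circleMap ⟨u₀, v₀⟩ ρ θ - ⟨u, v⟩)
  have hder : sliceCLM (vecEmb e x) hI (deriv (circleMap ⟨u₀, v₀⟩ ρ) θ) =
      (ρ * (-Real.sin θ)) • (1 : Cl) + (ρ * Real.cos θ) • vecEmb e x := by
    rw [sliceCLM_apply, deriv_circleMap, Algebra.algebraMap_eq_smul_one]
    simp [circleMap, Complex.exp_re, Complex.exp_im]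
  have hnegI : sliceCLM (vecEmb e x) hI (-Complex.I) = -vecEmb e x := by
    simp [sliceCLM_apply]
  rw [Complex.sub_re, Complex.sub_im, hre, him] at hinv
  rw [hre, him] at hval
  simp only [sliceCLM_mul, hinv, hval, hder, hnegI]
end
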